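/- Let ℱ = (F_n)_{n∈ℕ} be a left Følner sequence of nonempty finite subsets of ℚ (under addition), and let A ⊆ ℚ with d*_ℱ(A) > 0, where d*_ℱ(A) = sup{α : for all m ∈ ℕ there exist n ≥ m and q ∈ ℚ with |A ∩ (q + F_n)| ≥ α·|F_n|}. Then for each k ∈ ℕ there exists a nonzero rational number q such that d*_ℱ(A ∩ (−q + A) ∩ … ∩ (−kq + A)) > 0; in particular, there exist a nonzero rational q and p ∈ A with p + jq ∈ A for every 0 ≤ j ≤ k. -/

import Mathlib

open scoped symmDiff

/-- `(F_n)` is a left Følner sequence of nonempty finite subsets of `ℚ`. -/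
def IsLeftFolner (F : ℕ → Finset ℚ) : Prop :=
  (∀ n, (F n).Nonempty) ∧
    ∀ s : ℚ, Filter.Tendsto
      (fun n => ((((F n).image (s + ·)) ∆ (F n)).card : ℝ) / (F n).card)
      Filter.atTop (nhds 0)

/-- The Banach-type density
`d*_ℱ(A) = sup{α : (∀ m)(∃ n ≥ m)(∃ q ∈ ℚ)(|A ∩ (q + F_n)| ≥ α·|F_n|)}`. -/
noncomputable def dStar (F : ℕ → Finset ℚ) (A : Set ℚ) : ℝ :=
  sSup {α : ℝ | ∀ m : ℕ, ∃ n ≥ m, ∃ q : ℚ,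
    α * (F n).card ≤ (Set.ncard (A ∩ ↑((F n).image (q + ·))) : ℝ)}

namespace DHJ
open Classical

/-- average of a function over a finite type -/
noncomputable def av {X : Type*} [Finite X] (f : X → ℝ) : ℝ :=
  (∑ᶠ x, f x) / Nat.card X

/-- indicator of a proposition -/
noncomputable def ind (p : Prop) : ℝ := if p then 1 else 0

lemma ind_true {p : Prop} (h : p) : ind p = 1 := if_pos h
lemma ind_false {p : Prop} (h : ¬ p) : ind p = 0 := if_neg h
lemma ind_nonneg (p : Prop) : 0 ≤ ind p := by unfold ind; split_ifs <;> norm_num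
lemma ind_le_one (p : Prop) : ind p ≤ 1 := by unfold ind; split_ifs <;> norm_num
lemma ind_mono {p q : Prop} (h : p → q) : ind p ≤ ind q := by
  by_cases hp : p
  · rw [ind_true hp, ind_true (h hp)]
  · rw [ind_false hp]; exact ind_nonneg _

section av
variable {X Y : Type*} [Finite X] [Finite Y]

lemma av_eq {X : Type*} [Fintype X] (f : X → ℝ) : av f = (∑ x, f x) / Fintype.card X := by
  unfold av
  rw [finsum_eq_sum_of_fintype, Nat.card_eq_fintype_card]

lemma av_add (f g : X → ℝ) : av (fun x => f x + g x) = av f + av g := by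
  have := Fintype.ofFinite X
  simp only [av_eq, Finset.sum_add_distrib, add_div]

lemma av_sub (f g : X → ℝ) : av (fun x => f x - g x) = av f - av g := by
  have := Fintype.ofFinite X
  simp only [av_eq, Finset.sum_sub_distrib, sub_div]

lemma av_mul (c : ℝ) (f : X → ℝ) : av (fun x => c * f x) = c * av f := by
  have := Fintype.ofFinite X
  simp only [av_eq, ← Finset.mul_sum, mul_div_assoc]

lemma av_const [Nonempty X] (c : ℝ) : av (fun _ : X => c) = c := by
  have := Fintype.ofFinite X
  have h : (Fintype.card X : ℝ) ≠ 0 := by exact_mod_cast Fintype.card_ne_zero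
  simp only [av_eq, Finset.sum_const, Finset.card_univ, nsmul_eq_mul]
  field_simp

lemma av_mono {f g : X → ℝ} (h : ∀ x, f x ≤ g x) : av f ≤ av g := by
  have := Fintype.ofFinite X
  simp only [av_eq]
  gcongr
  exact h _

lemma av_nonneg {f : X → ℝ} (h : ∀ x, 0 ≤ f x) : 0 ≤ av f := by
  have := Fintype.ofFinite X
  simp only [av_eq]
  exact div_nonneg (Finset.sum_nonneg fun x _ => h x) (Nat.cast_nonneg _)

lemma av_le [Nonempty X] {f : X → ℝ} {c : ℝ} (h : ∀ x, f x ≤ c) : av f ≤ c := by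
  rw [← av_const (X := X) c]; exact av_mono h

lemma le_av [Nonempty X] {f : X → ℝ} {c : ℝ} (h : ∀ x, c ≤ f x) : c ≤ av f := by
  rw [← av_const (X := X) c]; exact av_mono h

lemma exists_av_le [Nonempty X] (f : X → ℝ) : ∃ x, av f ≤ f x := by
  by_contra! h
  have := Fintype.ofFinite X
  have h1 : ∑ x, f x < ∑ x : X, av f := Finset.sum_lt_sum_of_nonempty Finset.univ_nonempty
    fun x _ => h x
  have h0 : (0:ℝ) < Fintype.card X := by exact_mod_cast Fintype.card_pos
  rw [Finset.sum_const, Finset.card_univ, nsmul_eq_mul, av_eq] at h1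
  field_simp at h1
  exact lt_irrefl _ h1

lemma av_equiv (e : X ≃ Y) (f : Y → ℝ) : av (fun x => f (e x)) = av f := by
  have := Fintype.ofFinite X
  have := Fintype.ofFinite Y
  simp only [av_eq, Fintype.card_congr e, Equiv.sum_comp e f]

lemma av_prod (f : X × Y → ℝ) : av f = av fun x => av fun y => f (x, y) := by
  have := Fintype.ofFinite X
  have := Fintype.ofFinite Y
  simp only [av_eq, Fintype.sum_prod_type, Fintype.card_prod, Nat.cast_mul, ← Finset.sum_div]
  rw [div_div, mul_comm]

lemma av_comm (f : X → Y → ℝ) : (av fun x => av fun y => f x y) = av fun y => av fun x => f x y := by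
  rw [← av_prod (fun p : X × Y => f p.1 p.2), ← av_prod (fun p : Y × X => f p.2 p.1),
    ← av_equiv (Equiv.prodComm X Y)]
  rfl

lemma av_sumtype {ι κ β : Type*} [Finite ι] [Finite κ] [Finite β] (f : (ι ⊕ κ → β) → ℝ) :
    av f = av fun x : ι → β => av fun y : κ → β => f (Sum.elim x y) := by
  rw [← av_equiv (Equiv.sumArrowEquivProdArrow ι κ β).symm, av_prod]
  rfl

lemma av_fsum {W : Type*} [Fintype W] (f : W → X → ℝ) :
    av (fun x => ∑ w, f w x) = ∑ w, av (f w) := by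
  have := Fintype.ofFinite X
  simp only [av_eq, ← Finset.sum_div]
  rw [Finset.sum_comm]

/-- pigeonhole -/
lemma pigeon {W : Type*} [Finite W] {δ : ℝ} (hδ : 0 < δ) (P : W → X → Prop)
    (h : δ ≤ av fun x => ind (∃ w, P w x)) : ∃ w, δ / Nat.card W ≤ av fun x => ind (P w x) := by
  have := Fintype.ofFinite W
  have h1 : (av fun x => ind (∃ w, P w x)) ≤ ∑ w, av fun x => ind (P w x) := by
    rw [← av_fsum]
    apply av_mono
    intro x
    by_cases hx : ∃ w, P w x
    · obtain ⟨w, hw⟩ := hx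
      rw [ind_true ⟨w, hw⟩, ← ind_true hw]
      exact Finset.single_le_sum (f := fun w => ind (P w x)) (fun _ _ => ind_nonneg _)
        (Finset.mem_univ w)
    · rw [ind_false hx]
      exact Finset.sum_nonneg fun _ _ => ind_nonneg _
  by_contra! h2
  rcases isEmpty_or_nonempty W with hW | hW
  · have h4 : (av fun x => ind (∃ w, P w x)) ≤ 0 := by simpa using h1
    linarith
  have h3 : ∑ w, av (fun x => ind (P w x)) < ∑ w : W, δ / Nat.card W :=
    Finset.sum_lt_sum_of_nonempty Finset.univ_nonempty fun x _ => h2 x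
  have h0 : (0:ℝ) < Fintype.card W := by exact_mod_cast Fintype.card_pos
  rw [Finset.sum_const, Finset.card_univ, nsmul_eq_mul, Nat.card_eq_fintype_card] at h3
  field_simp at h3
  linarith

/-- Markov -/
lemma markov [Nonempty X] {δ : ℝ} (hδ : 0 < δ) {g : X → ℝ} (hg : ∀ x, g x ≤ 1)
    (h : δ ≤ av g) : δ / 2 ≤ av fun x => ind (δ / 2 ≤ g x) := by
  have : av g ≤ av fun x => ind (δ / 2 ≤ g x) + δ / 2 := by
    apply av_mono
    intro x
    by_cases hx : δ / 2 ≤ g x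
    · rw [ind_true hx]; linarith [hg x]
    · rw [ind_false hx]; linarith
  rw [av_add, av_const] at this
  linarith

lemma av_low [Nonempty X] {F : X → ℝ} {d ε : ℝ} (hε : 0 ≤ ε) (h1 : ∀ x, F x ≤ d + ε)
    (h2 : d - ε ≤ av F) (x : X) : d - 2 * Nat.card X * ε ≤ F x := by
  have := Fintype.ofFinite X
  have h0 : (0:ℝ) < Fintype.card X := by exact_mod_cast Fintype.card_pos
  rw [av_eq, le_div_iff₀ h0] at h2
  have h3 : ∑ y ∈ Finset.univ.erase x, F y ≤ ∑ y ∈ Finset.univ.erase x, (d + ε) :=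
    Finset.sum_le_sum fun y _ => h1 y
  rw [← Finset.add_sum_erase _ _ (Finset.mem_univ x)] at h2
  have h4 : ((Finset.univ.erase x).card : ℝ) = Fintype.card X - 1 := by
    rw [Finset.card_erase_of_mem (Finset.mem_univ x), Finset.card_univ, Nat.cast_sub]
    · simp
    · exact Fintype.card_pos
  rw [Finset.sum_const, nsmul_eq_mul, h4] at h3
  rw [Nat.card_eq_fintype_card]
  nlinarith

lemma av_pi_prod {ι β : Type*} [Fintype ι] [Finite β] (φ : β → ℝ) :
    (av fun x : ι → β => ∏ i, φ (x i)) = (av φ) ^ Fintype.card ι := by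
  have := Fintype.ofFinite β
  rw [av_eq, av_eq, div_pow, Fintype.card_fun, Nat.cast_pow]
  congr 1
  rw [← Finset.card_univ, ← Finset.prod_const, Finset.prod_univ_sum]
  simp
end av
end DHJ

namespace DHJ
open Classical

/-- combinatorial subspace map -/
def Sub {β η ι : Type} (g : (η → β) → (ι → β)) : Prop :=
  ∃ V : ι → β ⊕ η, (∀ e, ∃ i, V i = Sum.inr e) ∧ ∀ w i, g w i = Sum.elim id w (V i)

/-- clean subspace map: constants avoid `none` -/
def CSub {α η ι : Type} (g : (η → Option α) → (ι → Option α)) : Prop :=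
  ∃ V : ι → α ⊕ η, (∀ e, ∃ i, V i = Sum.inr e) ∧ ∀ w i, g w i = Sum.elim some w (V i)

def LineFree {β ι : Type} (A : Set (ι → β)) : Prop :=
  ∀ w : ι → Option β, (∃ j, w j = none) → ∃ b, (fun j => (w j).getD b) ∉ A

def DH (β : Type) [Finite β] : Prop :=
  ∀ δ : ℝ, 0 < δ → ∃ (ι : Type) (_ : Finite ι), ∀ A : Set (ι → β), LineFree A →
    av (fun x => ind (x ∈ A)) < δ

def sb {α ι : Type} (a : α) (v : ι → Option α) : ι → Option α := fun j => some ((v j).getD a)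

def Insens {α ι : Type} (a : α) (D : Set (ι → Option α)) : Prop := ∀ v, v ∈ D ↔ sb a v ∈ D

lemma sb_sb {α ι : Type} (a : α) (v : ι → Option α) : sb a (sb a v) = sb a v := by
  funext j; simp [sb]

lemma Sub.refl' {β η : Type} : Sub (fun w : η → β => w) :=
  ⟨Sum.inr, fun e => ⟨e, rfl⟩, fun _ _ => rfl⟩

lemma Sub.comp {β η ι κ : Type} {f : (ι → β) → (κ → β)} {g : (η → β) → (ι → β)}
    (hf : Sub f) (hg : Sub g) : Sub (fun w => f (g w)) := by
  obtain ⟨V, hV, hf⟩ := hf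
  obtain ⟨U, hU, hg⟩ := hg
  refine ⟨fun k => Sum.elim Sum.inl U (V k), fun e => ?_, fun w k => ?_⟩
  · obtain ⟨i, hi⟩ := hU e
    obtain ⟨k, hk⟩ := hV i
    exact ⟨k, by simp [hk, hi]⟩
  · show f (g w) k = _
    rw [hf]
    cases h : V k <;> simp [h, hg]

lemma CSub.comp {α η ι κ : Type} {f : (ι → Option α) → (κ → Option α)}
    {g : (η → Option α) → (ι → Option α)}
    (hf : CSub f) (hg : CSub g) : CSub (fun w => f (g w)) := by
  obtain ⟨V, hV, hf⟩ := hf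
  obtain ⟨U, hU, hg⟩ := hg
  refine ⟨fun k => Sum.elim Sum.inl U (V k), fun e => ?_, fun w k => ?_⟩
  · obtain ⟨i, hi⟩ := hU e
    obtain ⟨k, hk⟩ := hV i
    exact ⟨k, by simp [hk, hi]⟩
  · show f (g w) k = _
    rw [hf]
    cases h : V k <;> simp [h, hg]

lemma Sub.reindex {β η ι : Type} (e : ι ≃ η) : Sub (fun (w : η → β) (i : ι) => w (e i)) :=
  ⟨fun i => Sum.inr (e i), fun x => ⟨e.symm x, by simp⟩, fun _ _ => rfl⟩

lemma CSub.reindex {α η ι : Type} (e : ι ≃ η) :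
    CSub (fun (w : η → Option α) (i : ι) => w (e i)) :=
  ⟨fun i => Sum.inr (e i), fun x => ⟨e.symm x, by simp⟩, fun _ _ => rfl⟩

lemma CSub.sub {α η ι : Type} {g : (η → Option α) → (ι → Option α)} (h : CSub g) : Sub g := by
  obtain ⟨V, hV, h⟩ := h
  refine ⟨fun i => Sum.map some (fun x => x) (V i), fun e => ?_, fun w i => ?_⟩
  · obtain ⟨i, hi⟩ := hV e
    exact ⟨i, by simp [hi]⟩
  · rw [h]; cases hi : V i <;> simp [hi]

lemma CSub.sb {α η ι : Type} {g : (η → Option α) → (ι → Option α)} (h : CSub g) (a : α)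
    (w : η → Option α) : g (sb a w) = sb a (g w) := by
  obtain ⟨V, hV, h⟩ := h
  funext i
  simp only [h, DHJ.sb]
  cases V i <;> simp [DHJ.sb]

lemma Sub.inl {β ι κ : Type} (y : κ → β) : Sub (fun x : ι → β => (Sum.elim x y : ι ⊕ κ → β)) :=
  ⟨Sum.elim Sum.inr (fun k => Sum.inl (y k)), fun e => ⟨Sum.inl e, rfl⟩, fun w i => by
    cases i <;> simp⟩

lemma Sub.inr {β ι κ : Type} (y : κ → β) : Sub (fun x : ι → β => (Sum.elim y x : κ ⊕ ι → β)) :=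
  ⟨Sum.elim (fun k => Sum.inl (y k)) Sum.inr, fun e => ⟨Sum.inr e, rfl⟩, fun w i => by
    cases i <;> simp⟩

lemma Sub.inj {β η ι : Type} {g : (η → β) → (ι → β)} (h : Sub g) : Function.Injective g := by
  obtain ⟨V, hV, h⟩ := h
  intro w w' hw
  funext e
  obtain ⟨i, hi⟩ := hV e
  have := congrFun hw i
  simpa [h, hi] using this

lemma LineFree.pull {β η ι : Type} {A : Set (ι → β)} (hA : LineFree A)
    {g : (η → β) → (ι → β)} (h : Sub g) : LineFree {w | g w ∈ A} := by
  obtain ⟨V, hV, h⟩ := h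
  rintro w ⟨j, hj⟩
  obtain ⟨i, hi⟩ := hV j
  obtain ⟨b, hb⟩ := hA (fun i => Sum.elim some w (V i)) ⟨i, by simp [hi, hj]⟩
  refine ⟨b, fun hm => hb ?_⟩
  have hm' : g (fun j => (w j).getD b) ∈ A := hm
  convert hm' using 1
  funext k
  rw [h]
  cases V k <;> simp

lemma Insens.pull {α η ι : Type} {a : α} {D : Set (ι → Option α)} (hD : Insens a D)
    {g : (η → Option α) → (ι → Option α)} (h : Sub g) : Insens a {w | g w ∈ D} := by
  intro w
  show g w ∈ D ↔ g (sb a w) ∈ D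
  rw [hD, hD (g (sb a w))]
  have : sb a (g w) = sb a (g (sb a w)) := by
    obtain ⟨V, hV, h⟩ := h
    funext i
    simp only [DHJ.sb, h]
    cases V i <;> simp [DHJ.sb]
  rw [this]

/-- multidimensional density version -/
lemma multi {β : Type} [Finite β] [Nonempty β] (hD : DH β) (η : Type) [hη : Finite η] :
    ∀ δ : ℝ, 0 < δ → ∃ (ι : Type) (_ : Finite ι), ∀ A : Set (ι → β),
      δ ≤ av (fun x => ind (x ∈ A)) → ∃ g : (η → β) → (ι → β), Sub g ∧ ∀ w, g w ∈ A := by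
  induction η using Finite.induction_empty_option with
  | of_equiv e ih =>
    intro δ hδ
    obtain ⟨ι, hι, h⟩ := ih δ hδ
    refine ⟨ι, hι, fun A hA => ?_⟩
    obtain ⟨g, hg, h⟩ := h A hA
    exact ⟨_, hg.comp (Sub.reindex e), fun w => h _⟩
  | h_empty =>
    intro δ hδ
    refine ⟨PEmpty, inferInstance, fun A hA => ?_⟩
    obtain ⟨x, hx⟩ := exists_av_le (fun x => ind (x ∈ A))
    have hxA : x ∈ A := by
      by_contra hn
      rw [ind_false hn] at hx
      linarith
    exact ⟨fun w => w, Sub.refl', fun w => by rwa [Subsingleton.elim w x]⟩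
  | @h_option η _ ih =>
    intro δ hδ
    obtain ⟨ι₂, hι₂, h₂⟩ := ih (δ / 2) (by linarith)
    have hc : (0:ℝ) < Nat.card ((η → β) → (ι₂ → β)) := by exact_mod_cast Nat.card_pos
    obtain ⟨ι₁, hι₁, h₁⟩ := hD (δ / 2 / Nat.card ((η → β) → (ι₂ → β))) (by positivity)
    refine ⟨ι₁ ⊕ ι₂, inferInstance, fun A hA => ?_⟩
    rw [av_sumtype] at hA
    have hm := markov hδ (fun x => av_le fun y => ind_le_one _) hA
    have hm2 : δ / 2 ≤ av fun x : ι₁ → β => ind (∃ g : (η → β) → (ι₂ → β),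
        Sub g ∧ ∀ w, Sum.elim x (g w) ∈ A) :=
      hm.trans (av_mono fun x => ind_mono fun hx => h₂ {y | Sum.elim x y ∈ A} hx)
    obtain ⟨g, hg⟩ := pigeon (by linarith) _ hm2
    have hnl : ¬ LineFree {x : ι₁ → β | Sub g ∧ ∀ w, Sum.elim x (g w) ∈ A} :=
      fun hl => absurd (h₁ _ hl) (not_lt.2 hg)
    unfold LineFree at hnl
    push Not at hnl
    obtain ⟨w0, ⟨j, hj⟩, hw0⟩ := hnl
    obtain ⟨b0⟩ := ‹Nonempty β›
    obtain ⟨V, hV, hgV⟩ := (hw0 b0).1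
    refine ⟨fun u => Sum.elim (fun j => (w0 j).getD (u none)) (g (fun e => u (some e))),
      ⟨Sum.elim (fun j => (w0 j).elim (Sum.inr none) Sum.inl)
        (fun i => Sum.map (fun x => x) some (V i)), ?_, ?_⟩, ?_⟩
    · rintro (_ | e)
      · exact ⟨Sum.inl j, by simp [hj]⟩
      · obtain ⟨i, hi⟩ := hV e
        exact ⟨Sum.inr i, by simp [hi]⟩
    · rintro u (j | i)
      · cases h : w0 j <;> simp [h]
      · simp only [Sum.elim_inr, hgV]
        cases V i <;> simp
    · intro u
      exact (hw0 (u none)).2 _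

end DHJ

namespace DHJ
open Classical

def mix {α ι : Type} (x : ι → Option α) (u : ι → α) : ι → Option α :=
  fun i => (x i).map fun _ => u i

lemma av_mix {α ι : Type} [Finite α] [Nonempty α] [Finite ι] (F : (ι → Option α) → ℝ) :
    av F = av fun x : ι → Option α => av fun u : ι → α => F (mix x u) := by
  let s : (ι → Option α) × (ι → α) → (ι → Option α) × (ι → α) :=
    fun p => (mix p.1 p.2, fun i => (p.1 i).getD (p.2 i))
  have hs : Function.Involutive s := by
    rintro ⟨x, u⟩
    refine Prod.ext (funext fun i => ?_) (funext fun i => ?_)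
    · cases h : x i <;> simp [s, mix, h]
    · cases h : x i <;> simp [s, mix, h]
  calc av F = av fun x : ι → Option α => av fun u : ι → α => F x := by simp only [av_const]
    _ = av fun p : (ι → Option α) × (ι → α) => F p.1 := (av_prod (fun p : (ι → Option α) × (ι → α) => F p.1)).symm
    _ = av fun p : (ι → Option α) × (ι → α) => F (hs.toPerm s p).1 :=
        (av_equiv (hs.toPerm s) (fun p => F p.1)).symm
    _ = _ := by rw [av_prod]; rfl

lemma av_extend {α ι κ : Type} [Finite α] [Nonempty α] [Finite ι] [Finite κ] {e : κ → ι}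
    (he : Function.Injective e) (F : (ι → α) → ℝ) :
    av F = av fun u : ι → α => av fun v : κ → α => F (Function.extend e v u) := by
  let s : (ι → α) × (κ → α) → (ι → α) × (κ → α) :=
    fun p => (Function.extend e p.2 p.1, fun j => p.1 (e j))
  have hs : Function.Involutive s := by
    rintro ⟨u, v⟩
    refine Prod.ext (funext fun i => ?_) (funext fun i => ?_)
    · by_cases h : ∃ j, e j = i
      · obtain ⟨j, rfl⟩ := h
        simp [s, he.extend_apply]
      · simp [s, Function.extend_apply' _ _ _ h]
    · simp [s, he.extend_apply]
  calc av F = av fun x : ι → α => av fun u : κ → α => F x := by simp only [av_const]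
    _ = av fun p : (ι → α) × (κ → α) => F p.1 := (av_prod (fun p : (ι → α) × (κ → α) => F p.1)).symm
    _ = av fun p : (ι → α) × (κ → α) => F (hs.toPerm s p).1 :=
        (av_equiv (hs.toPerm s) (fun p => F p.1)).symm
    _ = _ := by rw [av_prod]; rfl

lemma av_option_lt {α : Type} [Finite α] [Nonempty α] {φ : Option α → ℝ} (h0 : ∀ x, 0 ≤ φ x)
    (h1 : ∀ x, φ x ≤ 1) {x : Option α} (hx : φ x < 1) : 0 ≤ av φ ∧ av φ < 1 := by
  refine ⟨av_nonneg h0, ?_⟩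
  have := Fintype.ofFinite α
  rw [av_eq, div_lt_one (by exact_mod_cast Fintype.card_pos)]
  calc ∑ x, φ x < ∑ x : Option α, 1 :=
        Finset.sum_lt_sum (fun x _ => h1 x) ⟨x, Finset.mem_univ _, hx⟩
    _ = _ := by simp

/-- few non-`none` letters is rare -/
lemma tail {α : Type} [Finite α] [Nonempty α] (n : ℕ) {β : ℝ} (hβ : 0 < β) :
    ∃ L : ℕ, (av fun x : Fin L → Option α =>
      ind (Nat.card {i // x i ≠ none} < n)) ≤ β := by
  let φ : Option α → ℝ := fun x => if x = none then 1 else 1 / 2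
  obtain ⟨a⟩ := ‹Nonempty α›
  have : Nonempty α := ⟨a⟩
  obtain ⟨h0, h1⟩ := av_option_lt (φ := φ) (fun x => by simp only [φ]; split_ifs <;> norm_num)
    (fun x => by simp only [φ]; split_ifs <;> norm_num) (x := some a) (by simp [φ]; norm_num)
  obtain ⟨L, hL⟩ := exists_pow_lt_of_lt_one (show (0:ℝ) < β / 2 ^ n by positivity) h1
  refine ⟨L, ?_⟩
  calc (av fun x : Fin L → Option α => ind (Nat.card {i // x i ≠ none} < n))
      ≤ av fun x : Fin L → Option α => 2 ^ n * ∏ i, φ (x i) := by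
        apply av_mono
        intro x
        have hp : ∏ i, φ (x i) = (1 / 2) ^ Nat.card {i // x i ≠ none} := by
          simp only [φ]
          rw [Finset.prod_ite]
          simp [Fintype.card_subtype]
        by_cases h : Nat.card {i // x i ≠ none} < n
        · rw [ind_true h, hp, one_div, inv_pow, ← div_eq_mul_inv, one_le_div (by positivity)]
          exact pow_le_pow_right₀ (by norm_num) h.le
        · rw [ind_false h, hp]; positivity
    _ = 2 ^ n * (av φ) ^ L := by rw [av_mul, av_pi_prod, Fintype.card_fin]
    _ ≤ β := by
      rw [lt_div_iff₀ (by positivity)] at hL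
      linarith

lemma insens_subspace {α : Type} [Finite α] [Nonempty α] (hD : DH α) (a : α)
    (η : Type) [Finite η] {β : ℝ} (hβ : 0 < β) : ∃ (ι : Type) (_ : Finite ι),
      ∀ D : Set (ι → Option α), Insens a D → β ≤ av (fun x => ind (x ∈ D)) →
        ∃ g : (η → Option α) → (ι → Option α), Sub g ∧ ∀ w, g w ∈ D := by
  obtain ⟨ι₀, hι₀, h₀⟩ := multi hD η (β / 2) (by linarith)
  obtain ⟨L, hL⟩ := tail (α := α) (Nat.card ι₀) (show 0 < β / 4 by linarith)
  refine ⟨Fin L, inferInstance, fun D hDi hDd => ?_⟩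
  rw [av_mix] at hDd
  have hx : ∃ x : Fin L → Option α, Nat.card ι₀ ≤ Nat.card {i // x i ≠ none} ∧
      β / 2 ≤ av fun u : Fin L → α => ind (mix x u ∈ D) := by
    by_contra! hcon
    have : (av fun x : Fin L → Option α => av fun u : Fin L → α => ind (mix x u ∈ D)) ≤
        av fun x : Fin L → Option α => ind (Nat.card {i // x i ≠ none} < Nat.card ι₀) + β / 2 := by
      apply av_mono
      intro x
      by_cases hx : Nat.card {i // x i ≠ none} < Nat.card ι₀
      · rw [ind_true hx]
        have : (av fun u : Fin L → α => ind (mix x u ∈ D)) ≤ 1 := av_le fun _ => ind_le_one _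
        linarith
      · rw [ind_false hx]
        linarith [hcon x (not_lt.1 hx)]
    rw [av_add, av_const] at this
    linarith
  obtain ⟨x, hx1, hx2⟩ := hx
  obtain ⟨e⟩ : Nonempty (ι₀ ↪ {i // x i ≠ none}) := by
    have := Fintype.ofFinite ι₀
    rw [Nat.card_eq_fintype_card, Nat.card_eq_fintype_card] at hx1
    exact Function.Embedding.nonempty_of_card_le hx1
  have he : Function.Injective (fun j => (e j : Fin L)) :=
    Subtype.val_injective.comp e.injective
  rw [av_extend he] at hx2
  obtain ⟨u, hu⟩ := exists_av_le (fun u : Fin L → α => av fun v : ι₀ → α =>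
    ind (mix x (Function.extend (fun j => (e j : Fin L)) v u) ∈ D))
  obtain ⟨g, ⟨V, hV, hg⟩, hgD⟩ := h₀ {v | mix x (Function.extend (fun j => (e j : Fin L)) v u) ∈ D}
    (hx2.trans hu)
  let U : Fin L → Option α ⊕ η := fun i =>
    if x i = none then Sum.inl none else
      Function.extend (fun j => (e j : Fin L)) (fun j => Sum.map some (fun t => t) (V j))
        (fun i => Sum.inl (some (u i))) i
  refine ⟨fun w i => Sum.elim id w (U i), ⟨U, fun t => ?_, fun w i => rfl⟩, fun w => ?_⟩
  · obtain ⟨j, hj⟩ := hV t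
    refine ⟨e j, ?_⟩
    have := he.extend_apply (fun j => Sum.map some (fun t : η => t) (V j))
        (fun i => (Sum.inl (some (u i)) : Option α ⊕ η)) j
    simp only [U, if_neg (e j).2]
    rw [this, hj]; rfl
  · have h1 : mix x (Function.extend (fun j => (e j : Fin L)) (g fun t => (w t).getD a) u) ∈ D :=
      hgD _
    rw [hDi] at h1 ⊢
    convert h1 using 1
    funext i
    simp only [sb, mix, U]
    by_cases hxi : x i = none
    · simp [hxi]
    · obtain ⟨b, hb⟩ := Option.ne_none_iff_exists'.1 hxi
      rw [if_neg hxi, hb]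
      by_cases h : ∃ j, (e j : Fin L) = i
      · obtain ⟨j, rfl⟩ := h
        have h1 := he.extend_apply (fun j => Sum.map some (fun t : η => t) (V j))
          (fun i => (Sum.inl (some (u i)) : Option α ⊕ η)) j
        have h2 := he.extend_apply (g fun t => (w t).getD a) u j
        rw [h1]
        simp only [Option.map_some, Option.getD_some]
        rw [h2, hg]
        cases V j <;> simp
      · rw [Function.extend_apply' _ _ _ h, Function.extend_apply' _ _ _ h]
        simp

lemma av_ind_range {X W : Type} [Finite X] [Finite W] {g : W → X} (hg : Function.Injective g)
    (h : X → ℝ) : (av fun x => h x * ind (x ∈ Set.range g)) =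
      (Nat.card W / Nat.card X : ℝ) * av fun w => h (g w) := by
  have := Fintype.ofFinite X
  have := Fintype.ofFinite W
  rcases isEmpty_or_nonempty W with hW | hW
  · have : Set.range g = ∅ := Set.range_eq_empty g
    simp [this, ind, av]
  have h0 : (Fintype.card W : ℝ) ≠ 0 := by exact_mod_cast Fintype.card_ne_zero
  have h1 : ∑ x, h x * ind (x ∈ Set.range g) = ∑ w, h (g w) := by
    rw [← Finset.sum_image (s := Finset.univ) (g := g) (f := h) (fun a _ b _ hab => hg hab)]
    rw [← Finset.sum_subset (Finset.subset_univ (Finset.univ.image g))]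
    · apply Finset.sum_congr rfl
      intro x hx
      rw [ind_true (by simpa using hx), mul_one]
    · intro x _ hx
      rw [ind_false (by simpa using hx), mul_zero]
  simp only [av_eq, Nat.card_eq_fintype_card, h1]
  field_simp

/-- energy-free exhaustion by subspaces of an insensitive set -/
lemma exhaust {α : Type} [Finite α] [Nonempty α] (hD : DH α) (a : α)
    (η : Type) [Finite η] {β : ℝ} (hβ : 0 < β) : ∃ (ι : Type) (_ : Finite ι),
      ∀ D : Set (ι → Option α), Insens a D → ∀ h : (ι → Option α) → ℝ, (∀ x, h x ≤ 1) →
        (∀ g : (η → Option α) → (ι → Option α), Sub g → (∀ w, g w ∈ D) →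
          av (fun w => h (g w)) ≤ 0) → av (fun x => h x * ind (x ∈ D)) ≤ β := by
  obtain ⟨ι₁, hι₁, h₁⟩ := insens_subspace hD a η (show 0 < β / 2 by linarith)
  set c : ℝ := 1 / Nat.card (ι₁ → Option α) with hc
  have hcp : (0:ℝ) < Nat.card (ι₁ → Option α) := by exact_mod_cast Nat.card_pos
  have hc1 : (1:ℝ) ≤ Nat.card (ι₁ → Option α) := by exact_mod_cast Nat.card_pos
  have hc0 : 0 < c := by positivity
  have hcle : c ≤ 1 := by rw [hc, div_le_one hcp]; exact hc1
  have key : ∀ i : ℕ, ∃ (ι : Type) (_ : Finite ι),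
      ∀ D : Set (ι → Option α), Insens a D → ∀ h : (ι → Option α) → ℝ, (∀ x, h x ≤ 1) →
        (∀ g : (η → Option α) → (ι → Option α), Sub g → (∀ w, g w ∈ D) →
          av (fun w => h (g w)) ≤ 0) → av (fun x => h x * ind (x ∈ D)) ≤
            β / 2 * (1 - (1 - c) ^ i) + (1 - c) ^ i * av (fun x => ind (x ∈ D)) := by
    intro i
    induction i with
    | zero =>
      refine ⟨PEmpty, inferInstance, fun D _ h hh _ => ?_⟩
      simp only [pow_zero, sub_self, mul_zero, one_mul, zero_add]
      apply av_mono
      intro x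
      nlinarith [hh x, ind_nonneg (x ∈ D)]
    | succ i ih =>
      obtain ⟨ι₂, hι₂, h₂⟩ := ih
      refine ⟨ι₁ ⊕ ι₂, inferInstance, fun D hDi h hh hneg => ?_⟩
      have hR : ∀ S : Set (ι₁ → Option α), ∃ R ⊆ S,
          (Insens a S → β / 2 ≤ av (fun x => ind (x ∈ S)) → c ≤ av fun x => ind (x ∈ R)) ∧
          (R = ∅ ∨ ∃ g : (η → Option α) → (ι₁ → Option α), Sub g ∧ R = Set.range g) := by
        intro S
        by_cases hS : ∃ g : (η → Option α) → (ι₁ → Option α), Sub g ∧ ∀ w, g w ∈ S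
        · obtain ⟨g, hg, hgS⟩ := hS
          refine ⟨Set.range g, by rintro _ ⟨w, rfl⟩; exact hgS w, fun _ _ => ?_, Or.inr ⟨g, hg, rfl⟩⟩
          have := av_ind_range hg.inj (fun _ => 1)
          simp only [one_mul, av_const, mul_one] at this
          rw [this, hc]
          gcongr
          exact_mod_cast Nat.card_pos
        · exact ⟨∅, Set.empty_subset _, fun h3 h4 => absurd (h₁ S h3 h4) hS, Or.inl rfl⟩
      choose R hRS hRc hRg using hR
      let sl : (ι₂ → Option α) → Set (ι₁ → Option α) := fun y => {x | Sum.elim x y ∈ D}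
      have hsl : ∀ y, Insens a (sl y) := fun y => hDi.pull (Sub.inl y)
      have hslsb : ∀ y, sl (sb a y) = sl y := by
        intro y
        ext x
        exact ((hDi.pull (Sub.inr x)) y).symm
      let D' : (ι₁ → Option α) → Set (ι₂ → Option α) := fun x => {y | x ∈ sl y ∧ x ∉ R (sl y)}
      have hD' : ∀ x, Insens a (D' x) := by
        intro x y
        simp only [D', Set.mem_ofPred_eq, hslsb]
      have split1 : ∀ x y, ind (Sum.elim x y ∈ D) = ind (x ∈ R (sl y)) + ind (y ∈ D' x) := by
        intro x y
        by_cases hx : Sum.elim x y ∈ D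
        · by_cases hr : x ∈ R (sl y)
          · rw [ind_true hx, ind_true hr, ind_false]
            · norm_num
            · simp [D', hr]
          · rw [ind_true hx, ind_false hr, ind_true]
            · norm_num
            · exact ⟨hx, hr⟩
        · have hr : x ∉ R (sl y) := fun hr => hx (hRS _ hr)
          rw [ind_false hx, ind_false hr, ind_false]
          · norm_num
          · exact fun h => hx h.1
      -- density of the remainder
      have dens : (av fun x => av fun y => ind (y ∈ D' x)) ≤
          (1 - c) * av (fun x => ind (x ∈ D)) + β / 2 * c := by
        have e1 : av (fun x => ind (x ∈ D)) = (av fun y => av fun x => ind (x ∈ R (sl y))) +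
            av fun x => av fun y => ind (y ∈ D' x) := by
          rw [av_sumtype, av_comm (fun y x => ind (x ∈ R (sl y))), ← av_add]
          congr 1; funext x
          rw [← av_add]
          congr 1; funext y
          exact split1 x y
        have e2 : c * (av (fun x => ind (x ∈ D)) - β / 2) ≤
            av fun y => av fun x => ind (x ∈ R (sl y)) := by
          rw [av_sumtype, av_comm, ← av_const (X := ι₂ → Option α) (β / 2), ← av_sub, ← av_mul]
          apply av_mono
          intro y
          by_cases hy : β / 2 ≤ av fun x => ind (x ∈ sl y)
          · have h3 := hRc (sl y) (hsl y) hy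
            have h4 : (av fun x : ι₁ → Option α => ind (Sum.elim x y ∈ D)) ≤ 1 :=
              av_le fun _ => ind_le_one _
            nlinarith
          · have h3 : 0 ≤ av fun x => ind (x ∈ R (sl y)) := av_nonneg fun _ => ind_nonneg _
            have h4 : (av fun x : ι₁ → Option α => ind (Sum.elim x y ∈ D)) < β / 2 := not_le.1 hy
            nlinarith
        linarith
      have e3 : (av fun x => h x * ind (x ∈ D)) =
          (av fun y => av fun x => h (Sum.elim x y) * ind (x ∈ R (sl y))) +
            av fun x => av fun y => h (Sum.elim x y) * ind (y ∈ D' x) := by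
        rw [av_sumtype, av_comm (fun y x => h (Sum.elim x y) * ind (x ∈ R (sl y))), ← av_add]
        congr 1; funext x
        rw [← av_add]
        congr 1; funext y
        rw [split1 x y, mul_add]
      have e4 : (av fun y => av fun x => h (Sum.elim x y) * ind (x ∈ R (sl y))) ≤ 0 := by
        apply av_le
        intro y
        rcases hRg (sl y) with h5 | ⟨g, hg, h5⟩
        · apply av_le
          intro x
          rw [h5, ind_false (Set.notMem_empty x), mul_zero]
        · rw [h5, av_ind_range hg.inj (fun x => h (Sum.elim x y))]
          apply mul_nonpos_of_nonneg_of_nonpos (by positivity)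
          apply hneg _ ((Sub.inl y).comp hg)
          intro w
          exact hRS (sl y) (by rw [h5]; exact ⟨w, rfl⟩)
      have e5 : (av fun x => av fun y => h (Sum.elim x y) * ind (y ∈ D' x)) ≤
          β / 2 * (1 - (1 - c) ^ i) + (1 - c) ^ i * av fun x => av fun y => ind (y ∈ D' x) := by
        rw [← av_mul, ← av_const (X := ι₁ → Option α) (β / 2 * (1 - (1 - c) ^ i)), ← av_add]
        apply av_mono
        intro x
        apply h₂ (D' x) (hD' x) _ (fun _ => hh _)
        intro g hg hgD
        exact hneg _ ((Sub.inr x).comp hg) fun w => (hgD w).1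
      have h6 : 0 ≤ (1 - c) ^ i := pow_nonneg (by linarith) i
      have h7 := mul_le_mul_of_nonneg_left dens h6
      rw [pow_succ]
      nlinarith
  obtain ⟨i, hi⟩ := exists_pow_lt_of_lt_one (show (0:ℝ) < β / 2 by linarith)
    (show 1 - c < 1 by linarith)
  obtain ⟨ι, hι, h⟩ := key i
  refine ⟨ι, hι, fun D hDi f hf hneg => (h D hDi f hf hneg).trans ?_⟩
  have h1 : av (fun x => ind (x ∈ D)) ≤ 1 := av_le fun _ => ind_le_one _
  have h2 : 0 ≤ av (fun x => ind (x ∈ D)) := av_nonneg fun _ => ind_nonneg _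
  have h6 : 0 ≤ (1 - c) ^ i := pow_nonneg (by linarith) i
  nlinarith

lemma exhaust_list {α : Type} [Finite α] [Nonempty α] (hD : DH α) (l : List α) :
    ∀ (η : Type) (_ : Finite η) (β : ℝ), 0 < β → ∃ (ι : Type) (_ : Finite ι),
      ∀ D : α → Set (ι → Option α), (∀ a, Insens a (D a)) →
      ∀ h : (ι → Option α) → ℝ, (∀ x, h x ≤ 1) →
        β < av (fun x => h x * ind (∀ a ∈ l, x ∈ D a)) →
        ∃ g : (η → Option α) → (ι → Option α), Sub g ∧ 0 < av fun w => h (g w) := by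
  induction l with
  | nil =>
    intro η hη β hβ
    refine ⟨η, hη, fun D _ h _ hlt => ⟨fun w => w, Sub.refl', ?_⟩⟩
    simp [ind] at hlt
    linarith
  | cons a l ih =>
    intro η hη β hβ
    obtain ⟨ι', hι', h'⟩ := ih η hη (β / 2) (by linarith)
    obtain ⟨ι, hι, h1⟩ := exhaust hD a ι' (show 0 < β / 4 by linarith)
    refine ⟨ι, hι, fun D hDi h hh hlt => ?_⟩
    by_contra! hcon
    have := h1 (D a) (hDi a) (fun x => h x * ind (∀ b ∈ l, x ∈ D b) - β / 2) (fun x => by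
      have := hh x
      have h3 := ind_nonneg (∀ b ∈ l, x ∈ D b)
      have h4 := ind_le_one (∀ b ∈ l, x ∈ D b)
      nlinarith) ?_
    · have h5 : (av fun x => h x * ind (∀ b ∈ a :: l, x ∈ D b) - β / 2) ≤
          av fun x => (h x * ind (∀ b ∈ l, x ∈ D b) - β / 2) * ind (x ∈ D a) := by
        apply av_mono
        intro x
        by_cases hx : x ∈ D a
        · simp [hx, ind_true]
        · rw [ind_false hx, ind_false]
          · linarith
          · simp [hx]
      rw [av_sub, av_const] at h5
      linarith
    · intro g hg hgD
      rw [av_sub, av_const]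
      by_contra! hpos
      obtain ⟨g', hg', hp⟩ := h' (fun b => {w | g w ∈ D b}) (fun b => (hDi b).pull hg)
        (fun w => h (g w)) (fun w => hh _) (by
          have : β / 2 < av fun w => h (g w) * ind (∀ b ∈ l, g w ∈ D b) := by linarith
          exact this)
      exact absurd hp (not_lt.2 (hcon _ (hg.comp hg')))

end DHJ

namespace DHJ
open Classical

/-- same `none` pattern -/
def Eqv {α ι : Type} (w w' : ι → Option α) : Prop := ∀ i, w i = none ↔ w' i = none

lemma CSub.eqv {α η ι : Type} {g : (η → Option α) → (ι → Option α)} (h : CSub g)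
    {w w' : η → Option α} (hw : Eqv w w') : Eqv (g w) (g w') := by
  obtain ⟨V, hV, h⟩ := h
  intro i
  rw [h, h]
  cases V i with
  | inl a => simp
  | inr e => simpa using hw e

lemma CSub.hasNone {α η ι : Type} {g : (η → Option α) → (ι → Option α)} (h : CSub g)
    {w : η → Option α} (hw : ∃ i, w i = none) : ∃ i, g w i = none := by
  obtain ⟨V, hV, h⟩ := h
  obtain ⟨e, he⟩ := hw
  obtain ⟨i, hi⟩ := hV e
  exact ⟨i, by rw [h, hi]; simpa using he⟩

lemma CSub.refl' {α η : Type} : CSub (fun w : η → Option α => w) :=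
  ⟨Sum.inr, fun e => ⟨e, rfl⟩, fun _ _ => rfl⟩

lemma grA {α : Type} [Finite α] (η : Type) [hη : Finite η] :
    ∀ (κ : Type) (_ : Finite κ), ∃ (ι : Type) (_ : Finite ι), ∀ c : (ι → Option α) → κ,
      ∃ g : (η → Option α) → (ι → Option α), CSub g ∧ ∀ w w', Eqv w w' → c (g w) = c (g w') := by
  induction η using Finite.induction_empty_option with
  | of_equiv e ih =>
    intro κ hκ
    obtain ⟨ι, hι, h⟩ := ih κ hκ
    refine ⟨ι, hι, fun c => ?_⟩
    obtain ⟨g, hg, h⟩ := h c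
    exact ⟨_, hg.comp (CSub.reindex e), fun w w' hw => h _ _ ((CSub.reindex e).eqv hw)⟩
  | h_empty =>
    intro κ hκ
    refine ⟨PEmpty, inferInstance, fun c => ⟨fun w => w, CSub.refl', fun w w' _ => ?_⟩⟩
    rw [Subsingleton.elim w w']
  | @h_option η _ ih =>
    intro κ hκ
    obtain ⟨ι', hι', h'⟩ := ih (Option α → κ) inferInstance
    obtain ⟨N, hN, hl⟩ := Combinatorics.Line.exists_mono_in_high_dimension α ((ι' → Option α) → κ)
    refine ⟨N ⊕ ι', inferInstance, fun c => ?_⟩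
    obtain ⟨l, c0, hc0⟩ := hl (fun x v => c (Sum.elim (fun j => some (x j)) v))
    let L : Option α → N → Option α := fun t j => (l.idxFun j).elim t some
    have hL : ∀ a v, c (Sum.elim (L (some a)) v) = c0 v := by
      intro a v
      rw [← hc0 a]
      congr 2
      funext j
      simp only [L, Combinatorics.Line.coe_apply]
      cases l.idxFun j <;> simp
    obtain ⟨g', ⟨V, hV, hg'⟩, h⟩ := h' (fun v t => c (Sum.elim (L t) v))
    refine ⟨fun w => Sum.elim (L (w none)) (g' fun e => w (some e)),
      ⟨Sum.elim (fun j => (l.idxFun j).elim (Sum.inr none) Sum.inl)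
        (fun i => Sum.map (fun x => x) some (V i)), ?_, ?_⟩, ?_⟩
    · rintro (_ | e)
      · obtain ⟨j, hj⟩ := l.proper
        exact ⟨Sum.inl j, by simp [hj]⟩
      · obtain ⟨i, hi⟩ := hV e
        exact ⟨Sum.inr i, by simp [hi]⟩
    · rintro w (j | i)
      · simp only [L, Sum.elim_inl]
        cases l.idxFun j <;> simp
      · simp only [Sum.elim_inr, hg']
        cases V i <;> simp
    · intro w w' hw
      have h1 := congrFun (h (fun e => w (some e)) (fun e => w' (some e)) (fun e => hw _)) (w none)
      refine h1.trans ?_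
      show _ = c (Sum.elim (L (w' none)) (g' fun e => w' (some e)))
      have h2 := hw none
      cases h3 : w none with
      | none => rw [h2.1 h3]
      | some a =>
        cases h4 : w' none with
        | none => rw [h2.2 h4] at h3; cases h3
        | some b => rw [hL, hL]

def GP (α : Type) (p q : ℕ) (ι : Type) : Prop :=
  ∀ Good : (ι → Option α) → Prop, (∀ w w', Eqv w w' → (Good w ↔ Good w')) →
    (∃ g : (Fin p → Option α) → (ι → Option α), CSub g ∧ ∀ w, (∃ i, w i = none) → Good (g w)) ∨
    (∃ g : (Fin q → Option α) → (ι → Option α), CSub g ∧ ∀ w, (∃ i, w i = none) → ¬ Good (g w))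

lemma GP.symm {α : Type} {p q : ℕ} {ι : Type} (h : GP α p q ι) : GP α q p ι := by
  intro Good hG
  rcases h (fun w => ¬ Good w) (fun w w' hw => not_congr (hG w w' hw)) with h | ⟨g, hg, h⟩
  · exact Or.inr h
  · exact Or.inl ⟨g, hg, fun w hw => not_not.1 (h w hw)⟩

lemma GP.half {α : Type} [Nonempty α] {p q : ℕ} {ι : Type} (h : GP α p q ι)
    (Good : (Option ι → Option α) → Prop) (hG : ∀ w w', Eqv w w' → (Good w ↔ Good w'))
    (h0 : ∀ u, u none = none → Good u) :
    (∃ g : (Fin (p+1) → Option α) → (Option ι → Option α), CSub g ∧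
      ∀ w, (∃ i, w i = none) → Good (g w)) ∨
    (∃ g : (Fin q → Option α) → (Option ι → Option α), CSub g ∧
      ∀ w, (∃ i, w i = none) → ¬ Good (g w)) := by
  obtain ⟨a0⟩ := ‹Nonempty α›
  rcases h (fun v => Good (fun i => i.elim (some a0) v)) (fun w w' hw => hG _ _ (by
    rintro (_ | i)
    · simp
    · exact hw i)) with ⟨g, ⟨V, hV, hg⟩, h⟩ | ⟨g, ⟨V, hV, hg⟩, h⟩
  · left
    refine ⟨fun w i => i.elim (w 0) (g fun e => w e.succ),
      ⟨fun i => i.elim (Sum.inr 0) (fun i => Sum.map (fun x => x) Fin.succ (V i)), ?_, ?_⟩, ?_⟩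
    · intro e
      refine Fin.cases ⟨none, rfl⟩ (fun e => ?_) e
      obtain ⟨i, hi⟩ := hV e
      exact ⟨some i, by simp [hi]⟩
    · rintro w (_ | i)
      · simp
      · simp only [Option.elim, hg]
        cases V i <;> simp
    · rintro w ⟨i, hi⟩
      by_cases hw0 : w 0 = none
      · exact h0 _ hw0
      · have : ∃ e : Fin p, w e.succ = none := by
          revert hi
          refine Fin.cases (fun h => absurd h hw0) (fun e he => ⟨e, he⟩) i
        refine (hG _ _ ?_).1 (h _ this)
        rintro (_ | i)
        · simp [hw0]
        · rfl
  · right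
    refine ⟨fun w i => i.elim (some a0) (g w),
      ⟨fun i => i.elim (Sum.inl a0) V, ?_, ?_⟩, ?_⟩
    · intro e
      obtain ⟨i, hi⟩ := hV e
      exact ⟨some i, by simp [hi]⟩
    · rintro w (_ | i)
      · simp
      · simp only [Option.elim, hg]
    · intro w hw
      exact h w hw

lemma GP.base {α : Type} (q : ℕ) : GP α 0 q (Fin 0) := fun _ _ =>
  Or.inl ⟨fun w => w, CSub.refl', fun _ ⟨i, _⟩ => i.elim0⟩

lemma GP.lift {α : Type} {p q : ℕ} {ι ι' : Type} {Good : (ι → Option α) → Prop}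
    {f : (ι' → Option α) → (ι → Option α)} (hf : CSub f)
    (h : (∃ g : (Fin p → Option α) → (ι' → Option α), CSub g ∧
      ∀ w, (∃ i, w i = none) → Good (f (g w))) ∨
    (∃ g : (Fin q → Option α) → (ι' → Option α), CSub g ∧
      ∀ w, (∃ i, w i = none) → ¬ Good (f (g w)))) :
    (∃ g : (Fin p → Option α) → (ι → Option α), CSub g ∧ ∀ w, (∃ i, w i = none) → Good (g w)) ∨
    (∃ g : (Fin q → Option α) → (ι → Option α), CSub g ∧
      ∀ w, (∃ i, w i = none) → ¬ Good (g w)) := by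
  rcases h with ⟨g, hg, h⟩ | ⟨g, hg, h⟩
  · exact Or.inl ⟨_, hf.comp hg, h⟩
  · exact Or.inr ⟨_, hf.comp hg, h⟩

lemma GP.step {α : Type} [Finite α] [Nonempty α] {p q : ℕ} {ιa ιb : Type} [Finite ιa] [Finite ιb]
    (ha : GP α p (q+1) ιa) (hb : GP α (p+1) q ιb) : ∃ (ι : Type) (_ : Finite ι),
      GP α (p+1) (q+1) ι := by
  obtain ⟨ι', hι', hS⟩ :=
    Combinatorics.Subspace.exists_mono_in_high_dimension (Option α) Prop (ιa ⊕ ιb)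
  obtain ⟨a0⟩ := ‹Nonempty α›
  have : Nonempty α := ⟨a0⟩
  refine ⟨Option ι', inferInstance, fun Good hG => ?_⟩
  obtain ⟨l, c, hc⟩ := hS (fun x => Good (fun i => i.elim none x))
  let V : Option ι' → α ⊕ Option (ιa ⊕ ιb) := fun i => i.elim (Sum.inr none) fun i =>
    Sum.elim (fun b => b.elim (Sum.inr none) Sum.inl) (fun e => Sum.inr (some e)) (l.idxFun i)
  let H : (Option (ιa ⊕ ιb) → Option α) → (Option ι' → Option α) := fun w i =>
    Sum.elim some w (V i)
  have hH : CSub H := by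
    refine ⟨V, ?_, fun _ _ => rfl⟩
    rintro (_ | e)
    · exact ⟨none, rfl⟩
    · obtain ⟨i, hi⟩ := l.proper e
      exact ⟨some i, by simp [V, hi]⟩
  have hconst : ∀ u, u none = none → Good (H u) = c := by
    intro u hu
    rw [← hc (fun e => u (some e))]
    congr 1
    funext i
    rcases i with (_ | i)
    · simpa [H, V] using hu
    · simp only [H, V, Option.elim, Combinatorics.Subspace.coe_apply]
      rcases l.idxFun i with (_ | b) | e
      · simpa using hu
      · simp
      · simp
  by_cases hcc : c
  · let f : (Option ιa → Option α) → (Option (ιa ⊕ ιb) → Option α) := fun w i =>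
      i.elim (w none) (Sum.elim (fun j => w (some j)) (fun _ => some a0))
    have hf : CSub f := by
      refine ⟨fun i => i.elim (Sum.inr none) (Sum.elim (fun j => Sum.inr (some j))
        (fun _ => Sum.inl a0)), ?_, ?_⟩
      · rintro (_ | e)
        · exact ⟨none, rfl⟩
        · exact ⟨some (Sum.inl e), rfl⟩
      · rintro w (_ | i | i) <;> simp [f]
    apply GP.lift (hH.comp hf)
    apply GP.half ha (fun v => Good (H (f v)))
    · exact fun w w' hw => hG _ _ ((hH.comp hf).eqv hw)
    · intro u hu
      rw [hconst _ (by simpa [f] using hu)]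
      exact hcc
  · let f : (Option ιb → Option α) → (Option (ιa ⊕ ιb) → Option α) := fun w i =>
      i.elim (w none) (Sum.elim (fun _ => some a0) (fun j => w (some j)))
    have hf : CSub f := by
      refine ⟨fun i => i.elim (Sum.inr none) (Sum.elim (fun _ => Sum.inl a0)
        (fun j => Sum.inr (some j))), ?_, ?_⟩
      · rintro (_ | e)
        · exact ⟨none, rfl⟩
        · exact ⟨some (Sum.inr e), rfl⟩
      · rintro w (_ | i | i) <;> simp [f]
    apply GP.lift (hH.comp hf)
    have := GP.half hb.symm (fun v => ¬ Good (H (f v)))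
      (fun w w' hw => not_congr (hG _ _ ((hH.comp hf).eqv hw))) (by
        intro u hu
        rw [hconst _ (by simpa [f] using hu)]
        exact hcc)
    rcases this with h | h
    · exact Or.inr h
    · simp only [not_not] at h
      exact Or.inl h

lemma GP.ex {α : Type} [Finite α] [Nonempty α] : ∀ p q : ℕ, ∃ (ι : Type) (_ : Finite ι),
    GP α p q ι := by
  intro p
  induction p with
  | zero => exact fun q => ⟨Fin 0, inferInstance, GP.base q⟩
  | succ p ihp =>
    intro q
    induction q with
    | zero => exact ⟨Fin 0, inferInstance, (GP.base _).symm⟩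
    | succ q ihq =>
      obtain ⟨ιa, _, ha⟩ := ihp (q+1)
      obtain ⟨ιb, _, hb⟩ := ihq
      exact GP.step ha hb

lemma gr {α : Type} [Finite α] [Nonempty α] (M0 m : Type) [Finite M0] [Finite m] :
    ∃ (M : Type) (_ : Finite M), ∀ Good : (M → Option α) → Prop,
      (∀ V : (M0 → Option α) → (M → Option α), CSub V → ∃ w, (∃ i, w i = none) ∧ Good (V w)) →
      ∃ V : (m → Option α) → (M → Option α), CSub V ∧ ∀ w, (∃ i, w i = none) → Good (V w) := by
  obtain ⟨ι, hι, hR⟩ := GP.ex (α := α) (Nat.card m) (Nat.card M0)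
  obtain ⟨M, hM, hA⟩ := grA (α := α) ι Prop inferInstance
  refine ⟨M, hM, fun Good hG => ?_⟩
  obtain ⟨f, hf, hc⟩ := hA Good
  rcases hR (fun w => Good (f w)) (fun w w' hw => by rw [hc w w' hw]) with ⟨g, hg, h⟩ | ⟨g, hg, h⟩
  · let e := (Finite.equivFin m).symm
    exact ⟨_, (hf.comp hg).comp (CSub.reindex e), fun w hw => h _ ((CSub.reindex e).hasNone hw)⟩
  · let e := (Finite.equivFin M0).symm
    obtain ⟨w, hw, hgood⟩ := hG _ ((hf.comp hg).comp (CSub.reindex e))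
    exact absurd hgood (h _ ((CSub.reindex e).hasNone hw))

end DHJ

namespace DHJ
open Classical

def UB (β ι : Type) [Finite β] [Finite ι] (t : ℝ) : Prop :=
  ∀ A : Set (ι → β), LineFree A → av (fun x => ind (x ∈ A)) ≤ t

lemma UB.inl {β ι κ : Type} [Finite β] [Nonempty β] [Finite ι] [Finite κ] {t : ℝ}
    (h : UB β ι t) : UB β (ι ⊕ κ) t := by
  intro A hA
  rw [av_sumtype, av_comm]
  exact av_le fun y => h _ (hA.pull (Sub.inl y))

lemma UB.inr {β ι κ : Type} [Finite β] [Nonempty β] [Finite ι] [Finite κ] {t : ℝ}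
    (h : UB β ι t) : UB β (κ ⊕ ι) t := by
  intro A hA
  rw [av_sumtype]
  exact av_le fun y => h _ (hA.pull (Sub.inr y))

lemma incr {α : Type} [Finite α] [Nonempty α] (hD : DH α) {d θ : ℝ} (hd : 0 < d) (hθ : 0 < θ)
    {η : Type} [Finite η] (hU : UB (Option α) η (d + d * θ / 16)) :
    ∃ (ι : Type) (_ : Finite ι), ∀ (R : Type) [Finite R] (A : Set (ι ⊕ R → Option α)),
      LineFree A → (av fun w : ι ⊕ R → Option α => ind (∀ i, w i ≠ none)) ≤ d * θ / 16 →
      d - d * θ / 16 ≤ (av fun w => ind (w ∈ A)) →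
      θ / 2 ≤ (av fun w => ind (∀ a, sb a w ∈ A)) → False := by
  have := Fintype.ofFinite α
  have hdθ : 0 < d * θ := by positivity
  obtain ⟨ι, hι, hex⟩ := exhaust_list hD (Finset.univ.toList : List α) η inferInstance
    (d * θ / 4 / Fintype.card (Set α))
    (div_pos (by positivity) (by exact_mod_cast Fintype.card_pos))
  refine ⟨ι, hι, fun R _ A hA hno hFd hGd => ?_⟩
  set c : ℝ := d + d * θ / 16 with hc
  -- patterns
  let pat : (ι ⊕ R → Option α) → Set α := fun w => {a | sb a w ∈ A}
  let f : Set α → (ι ⊕ R → Option α) → ℝ := fun P w => (ind (w ∈ A) - c) * ind (pat w = P)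
  have hsum : ∀ w, ∑ P ∈ Finset.univ.erase Set.univ, f P w =
      (ind (w ∈ A) - c) * (1 - ind (∀ a, sb a w ∈ A)) := by
    intro w
    simp only [f]
    rw [← Finset.mul_sum]
    congr 1
    have h1 : ∑ P : Set α, ind (pat w = P) = 1 := by
      rw [Finset.sum_eq_single (pat w) (fun b _ hb => ind_false fun h => hb h.symm) (by simp),
        ind_true rfl]
    rw [← Finset.add_sum_erase _ _ (Finset.mem_univ Set.univ)] at h1
    have h2 : (pat w = Set.univ) = ∀ a, sb a w ∈ A := by
      simp [pat, Set.eq_univ_iff_forall]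
    rw [h2] at h1
    linarith
  have hlow : ∀ w, ind (w ∈ A) - ind (∀ i, w i ≠ none) - c + c * ind (∀ a, sb a w ∈ A) ≤
      (ind (w ∈ A) - c) * (1 - ind (∀ a, sb a w ∈ A)) := by
    intro w
    have : ind (w ∈ A) * ind (∀ a, sb a w ∈ A) ≤ ind (∀ i, w i ≠ none) := by
      by_cases h1 : ∀ i, w i ≠ none
      · rw [ind_true h1]
        nlinarith [ind_nonneg (w ∈ A), ind_le_one (w ∈ A), ind_nonneg (∀ a, sb a w ∈ A),
          ind_le_one (∀ a, sb a w ∈ A)]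
      · rw [ind_false h1]
        by_cases h2 : w ∈ A
        · rw [ind_false (p := ∀ a, sb a w ∈ A), mul_zero]
          intro h3
          push Not at h1
          obtain ⟨j, hj⟩ := h1
          obtain ⟨b, hb⟩ := hA (fun j => (w j).map some) ⟨j, by simp [hj]⟩
          apply hb
          cases b with
          | none =>
            convert h2 using 1
            funext j
            cases w j <;> simp
          | some a =>
            convert h3 a using 1
            funext j
            simp only [sb]
            cases w j <;> simp
        · rw [ind_false h2, zero_mul]
    nlinarith
  have htot : d * θ / 4 < ∑ P ∈ Finset.univ.erase Set.univ, av (f P) := by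
    have h1 : ∑ P ∈ Finset.univ.erase Set.univ, av (f P) =
        av fun w => ∑ P ∈ Finset.univ.erase Set.univ, f P w := by
      have := Fintype.ofFinite (ι ⊕ R → Option α)
      simp only [av_eq, ← Finset.sum_div]
      rw [Finset.sum_comm]
    have h2 := av_mono hlow
    rw [av_add, av_sub, av_sub, av_const, av_mul] at h2
    rw [h1, funext hsum]
    have h3 : c * (θ / 2) ≤ c * av fun w => ind (∀ a, sb a w ∈ A) := by
      gcongr
    have h4 : d * θ / 2 ≤ c * (θ / 2) := by
      rw [hc]; nlinarith
    linarith
  have hP : ∃ P, d * θ / 4 / Fintype.card (Set α) < av (f P) := by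
    by_contra! hcon
    have h1 : ∑ P ∈ Finset.univ.erase Set.univ, av (f P) ≤
        ∑ P ∈ Finset.univ.erase (Set.univ : Set α), d * θ / 4 / Fintype.card (Set α) :=
      Finset.sum_le_sum fun P _ => hcon P
    have h0 : (0:ℝ) < Fintype.card (Set α) := by exact_mod_cast Fintype.card_pos
    have h2 : ∑ P ∈ Finset.univ.erase (Set.univ : Set α), d * θ / 4 / Fintype.card (Set α) ≤
        ∑ P : Set α, d * θ / 4 / Fintype.card (Set α) :=
      Finset.sum_le_sum_of_subset_of_nonneg (Finset.subset_univ _) fun _ _ _ => by positivity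
    rw [Finset.sum_const _ (s := (Finset.univ : Finset (Set α))), Finset.card_univ,
      nsmul_eq_mul] at h2
    have h3 : (Fintype.card (Set α) : ℝ) * (d * θ / 4 / Fintype.card (Set α)) = d * θ / 4 := by
      field_simp
    linarith
  obtain ⟨P, hP⟩ := hP
  rw [av_sumtype, av_comm] at hP
  obtain ⟨y, hy⟩ := exists_av_le (fun y : R → Option α => av fun x : ι → Option α =>
    f P (Sum.elim x y))
  have hy := hP.trans_le hy
  let D : α → Set (ι ⊕ R → Option α) := fun a => {v | sb a v ∈ A ↔ a ∈ P}
  have hDi : ∀ a, Insens a (D a) := by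
    intro a v
    show (sb a v ∈ A ↔ a ∈ P) ↔ (sb a (sb a v) ∈ A ↔ a ∈ P)
    rw [sb_sb]
  obtain ⟨g, hg, hpos⟩ := hex (fun a => {x | Sum.elim x y ∈ D a})
    (fun a => (hDi a).pull (Sub.inl y)) (fun x => ind (Sum.elim x y ∈ A) - c)
    (fun x => by
      have := ind_le_one (Sum.elim x y ∈ A)
      linarith [show 0 < c by positivity]) (by
      refine hy.trans_eq (congrArg av (funext fun x => ?_))
      have e : (∀ a ∈ (Finset.univ.toList : List α), x ∈ {x | Sum.elim x y ∈ D a}) ↔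
          pat (Sum.elim x y) = P := by
        rw [Set.ext_iff]
        constructor
        · exact fun h a => h a (by simp)
        · exact fun h a _ => h a
      show _ * ind _ = _ * ind _
      rw [propext e])
  rw [av_sub, av_const] at hpos
  have := hU _ (hA.pull ((Sub.inl y).comp hg))
  have h2 : (av fun w => ind (Sum.elim (g w) y ∈ A)) ≤ c := this
  linarith

lemma nonone {α : Type} [Finite α] [Nonempty α] {κ : ℝ} (hκ : 0 < κ) :
    ∃ l : ℕ, ∀ (R S : Type) [Finite R] [Finite S],
      (av fun w : R ⊕ (S ⊕ Fin l) → Option α => ind (∀ i, w i ≠ none)) ≤ κ := by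
  obtain ⟨h0, h1⟩ := av_option_lt (α := α) (φ := fun x => ind (x ≠ none)) (fun x => ind_nonneg _)
    (fun x => ind_le_one _) (x := none) (by simp [ind])
  obtain ⟨l, hl⟩ := exists_pow_lt_of_lt_one hκ h1
  refine ⟨l, fun R S _ _ => ?_⟩
  rw [av_sumtype]
  refine av_le fun x => ?_
  rw [av_sumtype]
  refine av_le fun y => ?_
  refine le_trans ?_ hl.le
  have := av_pi_prod (ι := Fin l) (fun x : Option α => ind (x ≠ none))
  rw [Fintype.card_fin] at this
  rw [← this]
  apply av_mono
  intro w
  by_cases h : ∀ i, w i ≠ none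
  · rw [Finset.prod_eq_one fun i _ => ind_true (h i)]
    exact ind_le_one _
  · rw [ind_false]
    · exact Finset.prod_nonneg fun _ _ => ind_nonneg _
    · intro h2
      exact h fun i => h2 (Sum.inr (Sum.inr i))

lemma main_step {α : Type} [Finite α] [Nonempty α] (hD : DH α) : DH (Option α) := by
  by_contra hcon
  unfold DH at hcon
  push Not at hcon
  obtain ⟨δ1, hδ1, hcon⟩ := hcon
  let S : Set ℝ := {t | ∃ (ι : Type) (_ : Finite ι), UB (Option α) ι t}
  have hSlow : ∀ t ∈ S, δ1 ≤ t := by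
    rintro t ⟨ι, hι, h⟩
    obtain ⟨A, hA, hlt⟩ := hcon ι hι
    exact hlt.trans (h A hA)
  have hSne : S.Nonempty := ⟨1, PEmpty, inferInstance, fun A _ => av_le fun _ => ind_le_one _⟩
  set d := sInf S with hd
  have hdpos : 0 < d := hδ1.trans_le (le_csInf hSne hSlow)
  have U : ∀ ε : ℝ, 0 < ε → ∃ (ι : Type) (_ : Finite ι), UB (Option α) ι (d + ε) := by
    intro ε hε
    obtain ⟨t, ⟨ι, hι, h⟩, ht⟩ := exists_lt_of_csInf_lt hSne (show sInf S < d + ε by linarith)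
    exact ⟨ι, hι, fun A hA => (h A hA).trans ht.le⟩
  have L : ∀ (ε : ℝ) (_ : 0 < ε) (ι : Type) [Finite ι], ∃ A : Set (ι → Option α), LineFree A ∧
      d - ε ≤ av fun x => ind (x ∈ A) := by
    intro ε hε ι hι
    by_contra! h
    have : d ≤ d - ε := csInf_le ⟨δ1, hSlow⟩ ⟨ι, hι, fun A hA => (h A hA).le⟩
    linarith
  obtain ⟨M0, hM0, hM0D⟩ := hD (d / 4) (by linarith)
  have hcard : (1:ℝ) ≤ Nat.card (M0 → Option α) := by exact_mod_cast Nat.card_pos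
  set θ : ℝ := d / 4 / Nat.card (M0 → Option α) with hθ
  have hθ0 : 0 < θ := by positivity
  have hθd : θ ≤ d / 4 := div_le_self (by linarith) hcard
  have hd1 : d ≤ 1 := csInf_le ⟨δ1, hSlow⟩
    ⟨PEmpty, inferInstance, fun A _ => av_le fun _ => ind_le_one _⟩
  set κ : ℝ := d * θ / 16 with hκ
  have hκ0 : 0 < κ := by positivity
  have hκθ : 0 < κ * θ := by positivity
  have hκd : κ * θ / 8 ≤ d / 4 := by
    have : κ ≤ 1 := by rw [hκ]; nlinarith
    nlinarith
  obtain ⟨η, hη, hηU⟩ := U κ hκ0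
  obtain ⟨ι5, hι5, hincr⟩ := incr hD hdpos hθ0 hηU
  obtain ⟨ιU, hιU, hU⟩ := U (κ * θ / 8) (by linarith)
  obtain ⟨l, hl⟩ := nonone (α := α) hκ0
  obtain ⟨M, hM, hGR⟩ := gr (α := α) M0 (ι5 ⊕ (ιU ⊕ Fin l))
  have hcM : (0:ℝ) < Nat.card (M → Option α) := by exact_mod_cast Nat.card_pos
  set ε : ℝ := κ * θ / (16 * Nat.card (M → Option α)) with hε
  have hε0 : 0 < ε := by positivity
  obtain ⟨N, hN, hNU⟩ := U ε hε0
  obtain ⟨A, hA, hAd⟩ := L ε hε0 (M ⊕ N)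
  have hslice : ∀ y : M → Option α, d - κ * θ / 8 ≤
      av fun z : N → Option α => ind (Sum.elim y z ∈ A) := by
    intro y
    rw [av_sumtype] at hAd
    have := av_low hε0.le (fun x => hNU _ (hA.pull (Sub.inr x))) hAd y
    refine le_trans (le_of_eq ?_) this
    rw [hε]; field_simp; ring
  obtain ⟨V, hV, hVG⟩ := hGR
    (fun w => θ ≤ av fun z : N → Option α => ind (∀ a, Sum.elim (sb a w) z ∈ A)) (by
      intro V hV
      have h1 : d / 2 ≤ av fun z : N → Option α => av fun x : M0 → α =>
          ind (Sum.elim (V fun i => some (x i)) z ∈ A) := by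
        rw [av_comm]
        exact le_av fun x => le_trans (by linarith) (hslice _)
      have h2 := markov (by linarith) (fun x => av_le fun _ => ind_le_one _) h1
      rw [show d / 2 / 2 = d / 4 by ring] at h2
      have h3 : d / 4 ≤ av fun z : N → Option α => ind (∃ w : M0 → Option α,
          (∃ i, w i = none) ∧ ∀ a, Sum.elim (sb a (V w)) z ∈ A) := by
        refine h2.trans (av_mono fun z => ind_mono fun hz => ?_)
        by_contra! hno
        refine absurd (hM0D {x | Sum.elim (V fun i => some (x i)) z ∈ A} ?_) (not_lt.2 hz)
        intro w hw
        obtain ⟨a, ha⟩ := hno w hw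
        refine ⟨a, fun hm => ha ?_⟩
        rw [← hV.sb]
        exact hm
      obtain ⟨w, hw⟩ := pigeon (by linarith) _ h3
      have hwn : ∃ i, w i = none := by
        by_contra hwn
        have : (av fun z : N → Option α => ind ((∃ i, w i = none) ∧
            ∀ a, Sum.elim (sb a (V w)) z ∈ A)) ≤ 0 :=
          av_le fun z => by rw [ind_false (fun h => hwn h.1)]
        linarith
      exact ⟨w, hwn, hw.trans (av_mono fun z => ind_mono fun h => h.2)⟩)
  -- choose z
  obtain ⟨z, hz⟩ := exists_av_le (fun z : N → Option α =>
    (av fun w => ind (Sum.elim (V w) z ∈ A)) +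
      κ * av fun w => ind (∀ a, Sum.elim (V (sb a w)) z ∈ A))
  have hFG : d - κ * θ / 8 + κ * θ ≤ av (fun z : N → Option α =>
    (av fun w => ind (Sum.elim (V w) z ∈ A)) +
      κ * av fun w => ind (∀ a, Sum.elim (V (sb a w)) z ∈ A)) := by
    rw [av_add, av_mul]
    have h1 : d - κ * θ / 8 ≤ av (fun z : N → Option α =>
        (av fun w => ind (Sum.elim (V w) z ∈ A))) := by
      rw [av_comm]
      exact le_av fun w => hslice _
    have h2 : θ ≤ av (fun z : N → Option α =>
        av fun w => ind (∀ a, Sum.elim (V (sb a w)) z ∈ A)) := by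
      rw [av_comm]
      refine le_av fun w => ?_
      by_cases hw : ∃ i, w i = none
      · simpa only [hV.sb] using hVG w hw
      · have hsb : ∀ a, sb a w = w := by
          intro a
          funext i
          push Not at hw
          obtain ⟨b, hb⟩ := Option.ne_none_iff_exists'.1 (hw i)
          simp [sb, hb]
        simp only [hsb]
        refine le_trans ?_ ((hslice (V w)).trans (av_mono fun z => ind_mono fun h _ => h))
        linarith
    nlinarith
  have hz := hFG.trans hz
  have hsub : Sub (fun w => Sum.elim (V w) z) := (Sub.inl z).comp hV.sub
  have hA2 : LineFree {w | Sum.elim (V w) z ∈ A} := hA.pull hsub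
  have hFup : (av fun w => ind (Sum.elim (V w) z ∈ A)) ≤ d + κ * θ / 8 :=
    (UB.inr (UB.inl hU)) _ hA2
  have hGup : (av fun w => ind (∀ a, Sum.elim (V (sb a w)) z ∈ A)) ≤ 1 :=
    av_le fun _ => ind_le_one _
  refine hincr (ιU ⊕ Fin l) {w | Sum.elim (V w) z ∈ A} hA2 (hl _ _) ?_ ?_
  · show d - κ ≤ av fun w => ind (Sum.elim (V w) z ∈ A)
    nlinarith
  · show θ / 2 ≤ av fun w => ind (∀ a, Sum.elim (V (sb a w)) z ∈ A)
    by_contra! h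
    nlinarith

lemma DH.all (α : Type) [hα : Finite α] : ∀ (_ : Finite α), Nonempty α → DH α := by
  induction α using Finite.induction_empty_option with
  | @of_equiv α β e ih =>
    intro hβ hne δ hδ
    have hα' : Finite α := Finite.of_equiv β e.symm
    obtain ⟨ι, hι, h⟩ := ih hα' (hne.map e.symm) δ hδ
    refine ⟨ι, hι, fun A hA => ?_⟩
    have := h {x | (fun i => e (x i)) ∈ A} (by
      rintro w ⟨j, hj⟩
      obtain ⟨b, hb⟩ := hA (fun i => (w i).map e) ⟨j, by simp [hj]⟩
      refine ⟨e.symm b, fun hm => hb ?_⟩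
      have hm' : (fun i => e ((w i).getD (e.symm b))) ∈ A := hm
      convert hm' using 1
      funext i
      cases w i <;> simp)
    rw [← av_equiv (Equiv.arrowCongr (Equiv.refl ι) e)]
    exact this
  | h_empty => exact fun _ h => h.elim fun x => x.elim
  | @h_option α _ ih =>
    intro _ _
    rcases isEmpty_or_nonempty α with h | h
    · intro δ hδ
      refine ⟨Unit, inferInstance, fun A hA => ?_⟩
      refine lt_of_le_of_lt (av_le fun x => ?_) hδ
      obtain ⟨b, hb⟩ := hA (fun _ => none) ⟨(), rfl⟩
      rw [ind_false]
      intro hx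
      apply hb
      convert hx
      exact Subsingleton.elim _ _
    · exact main_step (ih inferInstance h)

end DHJ

namespace DHJ
open Classical

lemma av_finset {β : Type*} (F : Finset β) (P : β → Prop) :
    (av fun p : {p // p ∈ F} => ind (P p)) = ((F.filter P).card : ℝ) / F.card := by
  rw [av_eq, Fintype.card_coe]
  congr 1
  rw [Finset.sum_coe_sort F (fun p => ind (P p))]
  simp only [ind, Finset.sum_boole]

lemma ncard_tr (F : Finset ℚ) (A : Set ℚ) (q : ℚ) :
    Set.ncard (A ∩ ↑(F.image (q + ·))) = (F.filter fun p => q + p ∈ A).card := by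
  have : A ∩ ↑(F.image (q + ·)) = ↑((F.filter fun p => q + p ∈ A).image (q + ·)) := by
    ext x
    simp only [Set.mem_inter_iff, Finset.coe_image, Set.mem_image, Finset.mem_coe,
      Finset.mem_filter]
    constructor
    · rintro ⟨h, y, hy, rfl⟩
      exact ⟨y, ⟨hy, h⟩, rfl⟩
    · rintro ⟨y, ⟨hy, h⟩, rfl⟩
      exact ⟨h, y, hy, rfl⟩
  rw [this, Set.ncard_coe_finset, Finset.card_image_of_injective _ (add_right_injective q)]

lemma shift (F : Finset ℚ) (A : Set ℚ) (q s : ℚ) :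
    (F.filter fun p => q + p ∈ A).card ≤ (F.filter fun p => q + s + p ∈ A).card +
      ((F.image (s + ·)) ∆ F).card := by
  have : (F.filter fun p => q + p ∈ A) ⊆
      ((F.filter fun p => q + s + p ∈ A).image (s + ·)) ∪ ((F.image (s + ·)) ∆ F) := by
    intro p hp
    rw [Finset.mem_filter] at hp
    by_cases h : p ∈ F.image (s + ·)
    · obtain ⟨r, hr, rfl⟩ := Finset.mem_image.1 h
      apply Finset.mem_union_left
      refine Finset.mem_image.2 ⟨r, Finset.mem_filter.2 ⟨hr, ?_⟩, rfl⟩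
      rw [add_assoc]; exact hp.2
    · apply Finset.mem_union_right
      exact Finset.mem_symmDiff.2 (Or.inr ⟨hp.1, h⟩)
  refine (Finset.card_le_card this).trans ((Finset.card_union_le _ _).trans ?_)
  exact Nat.add_le_add_right Finset.card_image_le _

lemma bdd (F : ℕ → Finset ℚ) (hF : IsLeftFolner F) (A : Set ℚ) {α : ℝ}
    (h : ∀ m : ℕ, ∃ n ≥ m, ∃ q : ℚ,
      α * (F n).card ≤ (Set.ncard (A ∩ ↑((F n).image (q + ·))) : ℝ)) : α ≤ 1 := by
  obtain ⟨n, -, q, h⟩ := h 0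
  rw [ncard_tr] at h
  have h0 : (0:ℝ) < (F n).card := by exact_mod_cast (hF.1 n).card_pos
  have h1 : (((F n).filter fun p => q + p ∈ A).card : ℝ) ≤ (F n).card := by
    exact_mod_cast Finset.card_filter_le _ _
  by_contra! h2
  nlinarith

/-- constant part of a variable word -/
def base {ι : Type} [Fintype ι] {k : ℕ} (w : ι → Option (Fin (k + 1))) : ℚ :=
  ∑ j, (w j).elim 0 fun a => ((a : ℕ) : ℚ)

/-- number of wildcards -/
def wild {ι : Type} [Fintype ι] {k : ℕ} (w : ι → Option (Fin (k + 1))) : ℚ :=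
  ∑ j, (w j).elim 1 fun _ => 0

lemma base_wild {ι : Type} [Fintype ι] {k : ℕ} (w : ι → Option (Fin (k + 1))) (b : Fin (k + 1)) :
    ∑ j, ((((w j).getD b : Fin (k + 1)) : ℕ) : ℚ) = base w + ((b : ℕ) : ℚ) * wild w := by
  unfold base wild
  rw [Finset.mul_sum, ← Finset.sum_add_distrib]
  apply Finset.sum_congr rfl
  intro j _
  cases w j <;> simp

lemma wild_pos {ι : Type} [Fintype ι] {k : ℕ} (w : ι → Option (Fin (k + 1)))
    (h : ∃ j, w j = none) : 0 < wild w := by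
  obtain ⟨j, hj⟩ := h
  apply Finset.sum_pos'
  · intro i _
    cases w i <;> simp
  · exact ⟨j, Finset.mem_univ _, by simp [hj]⟩

lemma one_n {ι : Type} [Fintype ι] {k : ℕ} {a : ℝ} (ha : 0 < a)
    (hι : ∀ B : Set (ι → Fin (k + 1)), LineFree B → av (fun x => ind (x ∈ B)) < 3 * a / 8)
    (F : Finset ℚ) (hF : F.Nonempty) (A : Set ℚ) (q : ℚ)
    (hA : a * F.card ≤ (Set.ncard (A ∩ ↑(F.image (q + ·))) : ℝ))
    (hs : ∀ x : ι → Fin (k + 1),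
      ((((F.image ((∑ j, ((x j : ℕ) : ℚ)) + ·)) ∆ F).card : ℝ) / F.card) ≤ a / 4) :
    ∃ w : ι → Option (Fin (k + 1)), (∃ j, w j = none) ∧
      3 * a / 8 / Nat.card (ι → Option (Fin (k + 1))) * F.card ≤
        (Set.ncard ((⋂ j : Fin (k + 1), {x : ℚ | ((j : ℕ) : ℚ) * wild w + x ∈ A}) ∩
          ↑(F.image (q + base w + ·))) : ℝ) := by
  have h0 : (0:ℝ) < F.card := by exact_mod_cast hF.card_pos
  have : Nonempty {p // p ∈ F} := hF.to_subtype
  have h1 : 3 * a / 4 ≤ av fun p : {p // p ∈ F} => av fun x : ι → Fin (k + 1) =>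
      ind (q + (∑ j, ((x j : ℕ) : ℚ)) + p ∈ A) := by
    rw [av_comm]
    refine le_av fun x => ?_
    rw [av_finset F (fun p => q + (∑ j, ((x j : ℕ) : ℚ)) + p ∈ A), le_div_iff₀ h0]
    have h2 := shift F A q (∑ j, ((x j : ℕ) : ℚ))
    have h3 := hs x
    rw [div_le_iff₀ h0] at h3
    rw [ncard_tr] at hA
    have h4 : ((F.filter fun p => q + p ∈ A).card : ℝ) ≤
      (F.filter fun p => q + (∑ j, ((x j : ℕ) : ℚ)) + p ∈ A).card +
      ((F.image ((∑ j, ((x j : ℕ) : ℚ)) + ·)) ∆ F).card := by exact_mod_cast h2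
    linarith
  have h2 := markov (by linarith) (fun p => av_le fun _ => ind_le_one _) h1
  rw [show 3 * a / 4 / 2 = 3 * a / 8 by ring] at h2
  have h3 : 3 * a / 8 ≤ av fun p : {p // p ∈ F} => ind (∃ w : ι → Option (Fin (k + 1)),
      (∃ j, w j = none) ∧ ∀ b : Fin (k + 1), q + (base w + ((b : ℕ) : ℚ) * wild w) + p ∈ A) := by
    refine h2.trans (av_mono fun p => ind_mono fun hp => ?_)
    by_contra! hno
    refine absurd (hι {x | q + (∑ j, ((x j : ℕ) : ℚ)) + p ∈ A} ?_) (not_lt.2 hp)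
    intro w hw
    obtain ⟨b, hb⟩ := hno w hw
    refine ⟨b, fun hm => hb ?_⟩
    rw [← base_wild]
    exact hm
  obtain ⟨w, hw⟩ := pigeon (by linarith) _ h3
  have hc : (0:ℝ) < Nat.card (ι → Option (Fin (k + 1))) := by exact_mod_cast Nat.card_pos
  rw [av_finset F (fun p => (∃ j, w j = none) ∧
    ∀ b : Fin (k + 1), q + (base w + ((b : ℕ) : ℚ) * wild w) + p ∈ A), le_div_iff₀ h0] at hw
  refine ⟨w, ?_, hw.trans ?_⟩
  · by_contra hwn
    have h5 : (0:ℝ) < 3 * a / 8 / Nat.card (ι → Option (Fin (k + 1))) * F.card := by positivity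
    simp only [hwn, false_and, Finset.filter_false, Finset.card_empty, Nat.cast_zero] at hw
    linarith
  · rw [ncard_tr]
    norm_cast
    apply Finset.card_le_card
    intro p hp
    simp only [Finset.mem_filter] at hp
    refine Finset.mem_filter.2 ⟨hp.1, Set.mem_iInter.2 fun b => ?_⟩
    have := hp.2.2 b
    show ((b : ℕ) : ℚ) * wild w + (q + base w + p) ∈ A
    convert this using 1
    ring

lemma final (F : ℕ → Finset ℚ) (hF : IsLeftFolner F)
    (A : Set ℚ) (hA : 0 < dStar F A) (k : ℕ) :
    ∃ q : ℚ, q ≠ 0 ∧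
      0 < dStar F (⋂ j : Fin (k + 1), {x : ℚ | ((j : ℕ) : ℚ) * q + x ∈ A}) ∧
      ∃ p ∈ A, ∀ j : ℕ, j ≤ k → p + (j : ℚ) * q ∈ A := by
  unfold dStar at hA
  obtain ⟨a, haS, ha⟩ := exists_lt_of_lt_csSup (s := {α : ℝ | ∀ m : ℕ, ∃ n ≥ m, ∃ q : ℚ,
    α * (F n).card ≤ (Set.ncard (A ∩ ↑((F n).image (q + ·))) : ℝ)})
    ⟨0, fun m => ⟨m, le_rfl, 0, by rw [zero_mul]; positivity⟩⟩ hA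
  obtain ⟨ι, hι, hD⟩ := DH.all (Fin (k + 1)) inferInstance inferInstance (3 * a / 8) (by linarith)
  have := Fintype.ofFinite ι
  have hev : ∀ᶠ n in Filter.atTop, ∀ x : ι → Fin (k + 1),
      (((((F n).image ((∑ j, ((x j : ℕ) : ℚ)) + ·)) ∆ (F n)).card : ℝ) / (F n).card) ≤ a / 4 := by
    rw [Filter.eventually_all]
    intro x
    exact (hF.2 (∑ j, ((x j : ℕ) : ℚ))).eventually_le_const (by linarith)
  obtain ⟨n0, hn0⟩ := Filter.eventually_atTop.1 hev
  set θ : ℝ := 3 * a / 8 / Nat.card (ι → Option (Fin (k + 1))) with hθ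
  have hc : (0:ℝ) < Nat.card (ι → Option (Fin (k + 1))) := by exact_mod_cast Nat.card_pos
  have hθ0 : 0 < θ := by positivity
  have hw : ∃ w : ι → Option (Fin (k + 1)), (∃ j, w j = none) ∧
      ∀ m : ℕ, ∃ n ≥ m, ∃ q : ℚ, θ * (F n).card ≤
        (Set.ncard ((⋂ j : Fin (k + 1), {x : ℚ | ((j : ℕ) : ℚ) * wild w + x ∈ A}) ∩
          ↑((F n).image (q + ·))) : ℝ) := by
    by_contra! hcon
    have hcon' : ∀ w : ι → Option (Fin (k + 1)), ∃ m, (∃ j, w j = none) → ∀ n ≥ m, ∀ q : ℚ,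
        (Set.ncard ((⋂ j : Fin (k + 1), {x : ℚ | ((j : ℕ) : ℚ) * wild w + x ∈ A}) ∩
          ↑((F n).image (q + ·))) : ℝ) < θ * (F n).card := by
      intro w
      by_cases hw : ∃ j, w j = none
      · obtain ⟨m, hm⟩ := hcon w hw
        exact ⟨m, fun _ => hm⟩
      · exact ⟨0, fun h => absurd h hw⟩
    choose m hm using hcon'
    obtain ⟨n, hn, q, hq⟩ := haS (max n0 (Finset.univ.sup m))
    obtain ⟨w, hwn, hw⟩ := one_n ha hD (F n) (hF.1 n) A q hq
      (hn0 n ((le_max_left _ _).trans hn))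
    have := hm w hwn n ((Finset.le_sup (Finset.mem_univ w)).trans ((le_max_right _ _).trans hn))
      (q + base w)
    linarith
  obtain ⟨w, hwn, hw⟩ := hw
  refine ⟨wild w, (wild_pos w hwn).ne', ?_, ?_⟩
  · exact hθ0.trans_le (le_csSup ⟨1, fun b hb => bdd F hF _ hb⟩ hw)
  · obtain ⟨n, -, q, h⟩ := hw 0
    have h0 : (0:ℝ) < (F n).card := by exact_mod_cast (hF.1 n).card_pos
    have h1 : (0:ℝ) < Set.ncard ((⋂ j : Fin (k + 1), {x : ℚ | ((j : ℕ) : ℚ) * wild w + x ∈ A}) ∩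
          ↑((F n).image (q + ·))) := lt_of_lt_of_le (by positivity) h
    obtain ⟨p, hp, -⟩ := Set.nonempty_of_ncard_ne_zero (by exact_mod_cast h1.ne')
    rw [Set.mem_iInter] at hp
    have hp' : ∀ j : Fin (k + 1), ((j : ℕ) : ℚ) * wild w + p ∈ A := hp
    refine ⟨p, by simpa using hp' 0, fun j hj => ?_⟩
    have := hp' ⟨j, by omega⟩
    rwa [add_comm]

end DHJ

/-- If `A ⊆ ℚ` has positive Banach density `d*_ℱ` along a left Følner sequence, then for
each `k` there is a nonzero rational `q` with `d*_ℱ(A ∩ (−q+A) ∩ … ∩ (−kq+A)) > 0`; in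
particular there are such a `q` and `p ∈ A` with `p + jq ∈ A` for all `0 ≤ j ≤ k`. -/
theorem banach_density_multiple_intersection (F : ℕ → Finset ℚ) (hF : IsLeftFolner F)
    (A : Set ℚ) (hA : 0 < dStar F A) (k : ℕ) :
    ∃ q : ℚ, q ≠ 0 ∧
      0 < dStar F (⋂ j : Fin (k + 1), {x : ℚ | ((j : ℕ) : ℚ) * q + x ∈ A}) ∧
      ∃ p ∈ A, ∀ j : ℕ, j ≤ k → p + (j : ℚ) * q ∈ A := by
  exact DHJ.final F hF A hA k
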